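/- arXiv:1412.3006 — 5 statements merged into one kernel-verified Lean document; each statement's English description precedes it below -/
import Mathlib

section
/- Define C_0 = V_{H^n}^λ and C_{i+1} = V_{C_i}^0 for i ≥ 0 (each step is the Vasil'ev construction with identically zero function). Then for every s ≥ 1, letting N = 2^s(2n+2) − 1 be the length of C_s, there exists a permutation φ ∈ S_N with φ(C_s) = V_{H^{(N−1)/2}}^{λ_{(N−1)/2}}, i.e., C_s is equivalent to the Vasil'ev code built from the Hamming code H^{(N−1)/2} and the function λ_{(N−1)/2}. -/
set_option linter.unusedSectionVars false

/-- Binary vectors of length `|ι|`, indexed by `ι`. -/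
abbrev F (ι : Type*) : Type _ := ι → ZMod 2

section Defs

variable {ι : Type*}

/-- The support of a vector: the set of its nonzero coordinate positions. -/
def supp (x : F ι) : Set ι := {i | x i ≠ 0}

/-- Action of a permutation on binary vectors by permuting coordinates:
`(permAct π x) (π i) = x i`. -/
def permAct (π : Equiv.Perm ι) (x : F ι) : F ι := x ∘ π.symm

/-- The image `π(C)` of a code under a coordinate permutation. -/
def permCode (π : Equiv.Perm ι) (C : Set (F ι)) : Set (F ι) := permAct π '' C

/-- The translateCode `y + C` of a code. -/
def translateCode (y : F ι) (C : Set (F ι)) : Set (F ι) := (y + ·) '' C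

/-- `Sym(C) = {π : π(C) = C}`. -/
def SymSet (C : Set (F ι)) : Set (Equiv.Perm ι) := {π | permCode π C = C}

/-- `Rot(C) = {π : ∃ y ∈ C, y + π(C) = C}`. -/
def RotSet (C : Set (F ι)) : Set (Equiv.Perm ι) :=
  {π | ∃ y ∈ C, translateCode y (permCode π C) = C}

/-- `Rot_y(C) = {π : y + π(C) = C}`. -/
def RotAt (C : Set (F ι)) (y : F ι) : Set (Equiv.Perm ι) :=
  {π | translateCode y (permCode π C) = C}

/-- `Tr(C) = {y ∈ C : ∃ π, y + π(C) = C}`. -/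
def TrSet (C : Set (F ι)) : Set (F ι) :=
  {y | y ∈ C ∧ ∃ π : Equiv.Perm ι, translateCode y (permCode π C) = C}

/-- `Ker(C) = {x ∈ C : x + C = C}`. -/
def KerSet (C : Set (F ι)) : Set (F ι) := {x | x ∈ C ∧ translateCode x C = C}

/-- `Aut(C) = {(y, π) : y + π(C) = C}`. -/
def AutSet (C : Set (F ι)) : Set (F ι × Equiv.Perm ι) :=
  {p | translateCode p.1 (permCode p.2 C) = C}

/-- A (reduced) code is transitive if for every codeword `y` there is a permutation `π`
with `y + π(C) = C`. -/
def IsTransitive (C : Set (F ι)) : Prop :=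
  ∀ y ∈ C, ∃ π : Equiv.Perm ι, translateCode y (permCode π C) = C

/-- A code is propelinear if `Aut(C)` contains a subgroup acting regularly on `C`
(the group law is `(y, π) * (y', π') = (y + π(y'), π ∘ π')`, acting by `(y,π) • x = y + π(x)`). -/
def IsPropelinear (C : Set (F ι)) : Prop :=
  ∃ A : Set (F ι × Equiv.Perm ι),
    (∀ a ∈ A, translateCode a.1 (permCode a.2 C) = C) ∧
    ((0, 1) ∈ A) ∧
    (∀ a ∈ A, ∀ b ∈ A, (a.1 + permAct a.2 b.1, a.2 * b.2) ∈ A) ∧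
    (∀ a ∈ A, (permAct a.2⁻¹ a.1, a.2⁻¹) ∈ A) ∧
    (∀ c ∈ C, ∀ c' ∈ C, ∃! a, a ∈ A ∧ a.1 + permAct a.2 c = c')

variable [Fintype ι] [DecidableEq ι]

/-- A perfect (1-error-correcting) code: every vector is within Hamming distance 1 of
exactly one codeword. -/
def IsPerfect (C : Set (F ι)) : Prop :=
  ∀ x : F ι, ∃! c, c ∈ C ∧ hammingDist x c ≤ 1

/-- `STS(C, y) = {supp (x + y) : x ∈ C, d(x, y) = 3}`. -/
def STS (C : Set (F ι)) (y : F ι) : Set (Set ι) :=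
  {s | ∃ x ∈ C, hammingDist x y = 3 ∧ s = supp (x + y)}

/-- A reduced perfect code is homogeneous if each `STS(C,y)`, `y ∈ C`, is isomorphic
to `STS(C, 0)`. -/
def IsHomogeneous (C : Set (F ι)) : Prop :=
  ∀ y ∈ C, ∃ π : Equiv.Perm ι, (Set.image π) '' (STS C y) = STS C (0 : F ι)

/-- The (mod 2) weight `|x| = x_1 + ⋯ + x_n`. -/
def wt (x : F ι) : ZMod 2 := ∑ i, x i

/-- The scalar product `u · y = Σ u_i y_i (mod 2)`. -/
def dot (u y : F ι) : ZMod 2 := ∑ i, u i * y i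

/-- A linear code: a subspace of `F ι` (over `ZMod 2` it suffices to be closed under `+`). -/
def IsLinearCode (C : Set (F ι)) : Prop :=
  (0 : F ι) ∈ C ∧ ∀ x ∈ C, ∀ y ∈ C, x + y ∈ C

/-- A Hamming code: a linear perfect code. -/
def IsHammingCode (C : Set (F ι)) : Prop := IsLinearCode C ∧ IsPerfect C

/-- The `i`-component `R_i`: the linear span of the weight-3 codewords of `H` whose
support contains `i`. -/
def component (H : Set (F ι)) (i : ι) : Set (F ι) :=
  ↑(Submodule.span (ZMod 2) {x | x ∈ H ∧ hammingNorm x = 3 ∧ x i ≠ 0})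

/-- `lam` pierces `R` if it takes both values 0 and 1 on `R`. -/
def Pierces (lam : F ι → ZMod 2) (R : Set (F ι)) : Prop :=
  (∃ x ∈ R, lam x = 0) ∧ (∃ x ∈ R, lam x = 1)

/-- The vector `(a, b, c)` of length `2n+1`: coordinates `1..n` are `a`, coordinate `n+1`
is `b`, coordinates `n+2..2n+1` are `c`. -/
def vasVec (a : F ι) (b : ZMod 2) (c : F ι) : F (ι ⊕ Unit ⊕ ι) :=
  Sum.elim a (Sum.elim (fun _ => b) c)

/-- The Vasil'ev code `V_C^λ = {(x + y, |x| + λ(y), x) : x ∈ F^n, y ∈ C}`. -/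
def Vasiliev (C : Set (F ι)) (lam : F ι → ZMod 2) : Set (F (ι ⊕ Unit ⊕ ι)) :=
  {v | ∃ x : F ι, ∃ y ∈ C, v = vasVec (x + y) (wt x + lam y) x}

/-- The subspace `R_{n+1}^{2n+1} = {(x, |x|, x) : x ∈ F^n}`. -/
def Rmid : Set (F (ι ⊕ Unit ⊕ ι)) := {v | ∃ x : F ι, v = vasVec x (wt x) x}

/-- Underlying function of `τ_u`: swaps positions `i` and `i + n + 1` for `i ∈ supp u`. -/
def tauFun (u : F ι) : (ι ⊕ Unit ⊕ ι) → (ι ⊕ Unit ⊕ ι)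
  | Sum.inl i => if u i ≠ 0 then Sum.inr (Sum.inr i) else Sum.inl i
  | Sum.inr (Sum.inl _) => Sum.inr (Sum.inl ())
  | Sum.inr (Sum.inr i) => if u i ≠ 0 then Sum.inl i else Sum.inr (Sum.inr i)

theorem tauFun_involutive (u : F ι) : Function.Involutive (tauFun u) := by
  intro x
  rcases x with i | x
  · by_cases h : u i = 0 <;> simp [tauFun, h]
  · rcases x with u' | i
    · simp [tauFun]
    · by_cases h : u i = 0 <;> simp [tauFun, h]

/-- The permutation `τ_u`: the product of transpositions `(i, i+n+1)` over `i ∈ supp u`. -/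
def tau (u : F ι) : Equiv.Perm (ι ⊕ Unit ⊕ ι) :=
  Function.Involutive.toPerm (tauFun u) (tauFun_involutive u)

/-- The duplicator `σ_π`: fixes position `n+1`, sends `i ↦ π(i)` and `i+n+1 ↦ π(i)+n+1`. -/
def dup (π : Equiv.Perm ι) : Equiv.Perm (ι ⊕ Unit ⊕ ι) :=
  Equiv.sumCongr π (Equiv.sumCongr (Equiv.refl Unit) π)

/-- The extension of `λ` one step up the Vasil'ev recursion: `λ'(z) = λ(y)` for
`z ∈ (y, 0^{m+1}) + R_{m+1}^{2m+1}` (well defined by recovering `y` from `z`). -/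
def lamSucc (lam : F ι → ZMod 2) : F (ι ⊕ Unit ⊕ ι) → ZMod 2 :=
  fun z => lam (fun i => z (Sum.inl i) + z (Sum.inr (Sum.inr i)))

/-- `T = {y' ∈ H : (y', λ(y'), 0) ∈ Tr(V_H^λ)}`. -/
def Tset (H : Set (F ι)) (lam : F ι → ZMod 2) : Set (F ι) :=
  {y' | y' ∈ H ∧ vasVec y' (lam y') 0 ∈ TrSet (Vasiliev H lam)}

/-- The Assmus–Mattson Steiner triple system `S^θ` of order `2n+1`. -/
def AM (S : Set (Set ι)) (θ : Set ι → ZMod 2) : Set (Set (ι ⊕ Unit ⊕ ι)) :=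
  {T | (∃ i : ι, T = {Sum.inl i, Sum.inr (Sum.inl ()), Sum.inr (Sum.inr i)}) ∨
    (∃ s ∈ S, θ s = 0 ∧
      (T = Sum.inl '' s ∨
        ∃ a ∈ s, T = insert (Sum.inl a) ((fun i => Sum.inr (Sum.inr i)) '' (s \ {a})))) ∨
    (∃ s ∈ S, θ s = 1 ∧
      (T = (fun i => Sum.inr (Sum.inr i)) '' s ∨
        ∃ a ∈ s, T = insert (Sum.inr (Sum.inr a)) (Sum.inl '' (s \ {a}))))}

end Defs

/-- A Steiner triple system on the point set `α`. -/
def IsSTS {α : Type*} (S : Set (Set α)) : Prop :=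
  (∀ s ∈ S, s.ncard = 3) ∧ ∀ i j : α, i ≠ j → ∃! s, s ∈ S ∧ i ∈ s ∧ j ∈ s

/-- The Mollard code (with zero function) of the codes `C` and `D`. -/
def Mollard {t r : Type*} [Fintype t] [Fintype r] (C : Set (F t)) (D : Set (F r)) :
    Set (F ((t × r) ⊕ t ⊕ r)) :=
  {v | ∃ x : F (t × r), ∃ c ∈ C, ∃ d ∈ D,
    v = Sum.elim x (Sum.elim (fun i => c i + ∑ j, x (i, j)) (fun j => d j + ∑ i, x (i, j)))}

/-- Index types of the iterated Vasil'ev construction: lengths `n`, `2n+1`, `4n+3`, …. -/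
def HType (n : ℕ) : ℕ → Type
  | 0 => Fin n
  | s + 1 => HType n s ⊕ Unit ⊕ HType n s

def HType.ft (n : ℕ) : ∀ s, Fintype (HType n s)
  | 0 => inferInstanceAs (Fintype (Fin n))
  | s + 1 =>
      letI := HType.ft n s
      inferInstanceAs (Fintype (HType n s ⊕ Unit ⊕ HType n s))

instance (n s : ℕ) : Fintype (HType n s) := HType.ft n s

def HType.deq (n : ℕ) : ∀ s, DecidableEq (HType n s)
  | 0 => inferInstanceAs (DecidableEq (Fin n))
  | s + 1 =>
      letI := HType.deq n s
      inferInstanceAs (DecidableEq (HType n s ⊕ Unit ⊕ HType n s))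

instance (n s : ℕ) : DecidableEq (HType n s) := HType.deq n s

/-- The iterated Hamming codes `H^n, H^{2n+1} = V_{H^n}^0, H^{4n+3}, …`. -/
def Hcode (n : ℕ) (H : Set (F (Fin n))) : ∀ s, Set (F (HType n s))
  | 0 => H
  | s + 1 => Vasiliev (Hcode n H s) 0

/-- The iterated functions `λ_n = λ`, `λ_{2m+1}` extending `λ_m`. -/
def lamIter (n : ℕ) (lam : F (Fin n) → ZMod 2) : ∀ s, F (HType n s) → ZMod 2
  | 0 => lam
  | s + 1 => lamSucc (lamIter n lam s)

/-- `C_0 = V_{H^n}^λ`, `C_{s+1} = V_{C_s}^0`. -/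
def Ccode (n : ℕ) (H : Set (F (Fin n))) (lam : F (Fin n) → ZMod 2) :
    ∀ s, Set (F (HType n (s + 1)))
  | 0 => Vasiliev H lam
  | s + 1 => Vasiliev (Ccode n H lam s) 0

theorem mem_permCode {ι : Type*} (π : Equiv.Perm ι) (C : Set (F ι)) (v : F ι) :
    v ∈ permCode π C ↔ v ∘ π ∈ C := by
  constructor
  · rintro ⟨x, hx, rfl⟩
    have h : permAct π x ∘ π = x := by ext i; simp [permAct]
    rwa [h]
  · intro h
    exact ⟨v ∘ π, h, by ext i; simp [permAct]⟩

theorem permCode_one {ι : Type*} (C : Set (F ι)) : permCode 1 C = C := by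
  ext v
  rw [mem_permCode]
  rfl

theorem permCode_mul {ι : Type*} (π ρ : Equiv.Perm ι) (C : Set (F ι)) :
    permCode (π * ρ) C = permCode π (permCode ρ C) := by
  ext v
  simp only [mem_permCode]
  rfl

theorem mem_Vasiliev {ι : Type*} [Fintype ι] [DecidableEq ι] (C : Set (F ι)) (lam : F ι → ZMod 2)
    (v : F (ι ⊕ Unit ⊕ ι)) :
    v ∈ Vasiliev C lam ↔ (fun i => v (Sum.inl i) + v (Sum.inr (Sum.inr i))) ∈ C ∧
      v (Sum.inr (Sum.inl ())) = (∑ i, v (Sum.inr (Sum.inr i))) +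
        lam (fun i => v (Sum.inl i) + v (Sum.inr (Sum.inr i))) := by
  constructor
  · rintro ⟨x, y, hy, rfl⟩
    have h : (fun i => x i + y i + x i) = y := by
      ext i
      linear_combination CharTwo.add_self_eq_zero (x i)
    simpa [vasVec, wt, h] using hy
  · rintro ⟨hC, hv⟩
    refine ⟨fun i => v (Sum.inr (Sum.inr i)), _, hC, ?_⟩
    ext (i | u | i)
    · simp only [vasVec, Sum.elim_inl, Pi.add_apply]
      linear_combination -CharTwo.add_self_eq_zero (v (Sum.inr (Sum.inr i)))
    · simpa [vasVec, wt] using hv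
    · rfl

theorem permCode_dup_Vasiliev_zero {ι : Type*} [Fintype ι] [DecidableEq ι] (π : Equiv.Perm ι)
    (C : Set (F ι)) : permCode (dup π) (Vasiliev C 0) = Vasiliev (permCode π C) 0 := by
  ext v
  simp only [mem_permCode, mem_Vasiliev]
  refine and_congr Iff.rfl ?_
  have h : ∑ i, v (Sum.inr (Sum.inr (π i))) = ∑ i, v (Sum.inr (Sum.inr i)) :=
    Equiv.sum_comp π fun i => v (Sum.inr (Sum.inr i))
  simp [dup, h]

/-- Underlying function of `middleSwap`. -/
def middleSwapFun {ι : Type*} :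
    (ι ⊕ Unit ⊕ ι) ⊕ Unit ⊕ (ι ⊕ Unit ⊕ ι) → (ι ⊕ Unit ⊕ ι) ⊕ Unit ⊕ (ι ⊕ Unit ⊕ ι)
  | Sum.inl (Sum.inl i) => Sum.inl (Sum.inl i)
  | Sum.inl (Sum.inr (Sum.inl u)) => Sum.inr (Sum.inl u)
  | Sum.inl (Sum.inr (Sum.inr i)) => Sum.inr (Sum.inr (Sum.inl i))
  | Sum.inr (Sum.inl u) => Sum.inl (Sum.inr (Sum.inl u))
  | Sum.inr (Sum.inr (Sum.inl i)) => Sum.inl (Sum.inr (Sum.inr i))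
  | Sum.inr (Sum.inr (Sum.inr x)) => Sum.inr (Sum.inr (Sum.inr x))

theorem middleSwapFun_involutive {ι : Type*} :
    Function.Involutive (middleSwapFun (ι := ι)) := by
  rintro ((i | u | i) | u | (i | u | i)) <;> rfl

/-- The permutation of the positions of a twice iterated Vasil'ev code that exchanges the two
middle positions of the outer code and of its left half, and the right block of the left half
with the left block of the right half. -/
def middleSwap (ι : Type*) : Equiv.Perm ((ι ⊕ Unit ⊕ ι) ⊕ Unit ⊕ (ι ⊕ Unit ⊕ ι)) :=
  middleSwapFun_involutive.toPerm middleSwapFun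

theorem permCode_middleSwap {ι : Type*} [Fintype ι] [DecidableEq ι] (C : Set (F ι))
    (lam : F ι → ZMod 2) :
    permCode (middleSwap ι) (Vasiliev (Vasiliev C lam) 0) =
      Vasiliev (Vasiliev C 0) (lamSucc lam) := by
  ext v
  simp only [mem_permCode, mem_Vasiliev, lamSucc, Function.comp_apply, middleSwap,
    Function.Involutive.coe_toPerm, middleSwapFun, Fintype.sum_sum_type, Pi.zero_apply,
    Finset.univ_unique, Finset.sum_singleton, PUnit.default_eq_unit, add_zero,
    Finset.sum_add_distrib]
  have hy : (fun i => v (Sum.inl (Sum.inl i)) + v (Sum.inl (Sum.inr (Sum.inr i))) +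
      (v (Sum.inr (Sum.inr (Sum.inl i))) + v (Sum.inr (Sum.inr (Sum.inr (Sum.inr i)))))) =
      fun i => v (Sum.inl (Sum.inl i)) + v (Sum.inr (Sum.inr (Sum.inl i))) +
      (v (Sum.inl (Sum.inr (Sum.inr i))) + v (Sum.inr (Sum.inr (Sum.inr (Sum.inr i))))) := by
    ext i
    ring
  rw [hy, and_assoc, and_assoc]
  refine and_congr Iff.rfl ?_
  generalize lam _ = l
  generalize v (Sum.inr (Sum.inl ())) = b
  generalize v (Sum.inl (Sum.inr (Sum.inl ()))) = a
  generalize v (Sum.inr (Sum.inr (Sum.inr (Sum.inl ())))) = c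
  generalize ∑ i, v (Sum.inr (Sum.inr (Sum.inl i))) = p
  generalize ∑ i, v (Sum.inl (Sum.inr (Sum.inr i))) = q
  generalize ∑ i, v (Sum.inr (Sum.inr (Sum.inr (Sum.inr i)))) = r
  have hc := CharTwo.add_self_eq_zero c
  constructor <;> rintro ⟨h₁, h₂⟩ <;> constructor
  · linear_combination h₂ + hc
  · linear_combination h₁ - hc
  · linear_combination h₂ + hc
  · linear_combination h₁ - hc

theorem card_HType_add_one (n s : ℕ) : Fintype.card (HType n s) + 1 = 2 ^ s * (n + 1) := by
  induction s with
  | zero =>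
    have h : Fintype.card (HType n 0) = n := Fintype.card_fin n
    simp [h]
  | succ s ih =>
    have h : Fintype.card (HType n (s + 1)) = Fintype.card (HType n s ⊕ Unit ⊕ HType n s) := rfl
    rw [h, Fintype.card_sum, Fintype.card_sum, Fintype.card_unit, pow_succ]
    linarith

theorem exists_permCode_Ccode_eq {n : ℕ} (H : Set (F (Fin n))) (lam : F (Fin n) → ZMod 2) (s : ℕ) :
    ∃ φ : Equiv.Perm (HType n (s + 1)),
      permCode φ (Ccode n H lam s) = Vasiliev (Hcode n H s) (lamIter n lam s) := by
  induction s with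
  | zero => exact ⟨1, permCode_one _⟩
  | succ s ih =>
    obtain ⟨φ, hφ⟩ := ih
    let σ : Equiv.Perm (HType n (s + 2)) := middleSwap (HType n s)
    let δ : Equiv.Perm (HType n (s + 2)) := dup φ
    have hδ : permCode δ (Ccode n H lam (s + 1)) =
        Vasiliev (Vasiliev (Hcode n H s) (lamIter n lam s)) 0 :=
      (permCode_dup_Vasiliev_zero φ _).trans (congrArg (Vasiliev · 0) hφ)
    exact ⟨σ * δ, (permCode_mul σ δ _).trans <|
      (congrArg (permCode σ) hδ).trans (permCode_middleSwap _ _)⟩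

/-- STATEMENT 13: `C_s` is equivalent to the Vasil'ev code `V_{H^{(N-1)/2}}^{λ_{(N-1)/2}}`,
where `N = 2^s(2n+2) - 1` is the length of `C_s`. -/
theorem stmt13 {n : ℕ} (H : Set (F (Fin n))) (hH : IsHammingCode H)
    (lam : F (Fin n) → ZMod 2) (hlam : lam 0 = 0) (s : ℕ) (hs : 1 ≤ s) :
    Fintype.card (HType n (s + 1)) + 1 = 2 ^ s * (2 * n + 2) ∧
    ∃ φ : Equiv.Perm (HType n (s + 1)),
      permCode φ (Ccode n H lam s) = Vasiliev (Hcode n H s) (lamIter n lam s) := by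
  refine ⟨?_, exists_permCode_Ccode_eq H lam s⟩
  rw [card_HType_add_one]
  ring
end

section
/- For any length m occurring in the recursion and any 1 ≤ j ≤ m: if λ_m pierces the component R_j^m of H^m, then λ_{2m+1} pierces both components R_j^{2m+1} and R_{j+m+1}^{2m+1} of H^{2m+1}. -/
set_option linter.unusedSectionVars false

section Projection

variable {ι : Type*}

/-- The linear map `z ↦ y` recovering `y` from a vector `z ∈ (y, 0) + {(x, |x|, x)}`. -/
def vasProj (ι : Type*) : F (ι ⊕ Unit ⊕ ι) →ₗ[ZMod 2] F ι :=
  LinearMap.funLeft (ZMod 2) (ZMod 2) Sum.inl +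
    LinearMap.funLeft (ZMod 2) (ZMod 2) (fun i => Sum.inr (Sum.inr i))

theorem vasProj_vasVec (a : F ι) (b : ZMod 2) (c : F ι) :
    vasProj ι (vasVec a b c) = a + c := rfl

theorem Pierces.lamSucc {lam : F ι → ZMod 2} {R : Set (F ι)} {R' : Set (F (ι ⊕ Unit ⊕ ι))}
    (h : Pierces lam R) (hR : R ⊆ vasProj ι '' R') : Pierces (lamSucc lam) R' := by
  have lift {v : ZMod 2} (hv : ∃ x ∈ R, lam x = v) : ∃ z ∈ R', _root_.lamSucc lam z = v := by
    obtain ⟨x, hx, rfl⟩ := hv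
    obtain ⟨z, hz, rfl⟩ := hR hx
    exact ⟨z, hz, rfl⟩
  exact ⟨lift h.1, lift h.2⟩

variable [Fintype ι]

theorem hammingNorm_vasVec_zero (a c : F ι) :
    hammingNorm (vasVec a 0 c) = hammingNorm a + hammingNorm c := by
  simp only [hammingNorm, Finset.card_filter, Fintype.sum_sum_type]
  simp only [vasVec, Sum.elim_inl, Sum.elim_inr, Finset.univ_unique, Finset.sum_singleton,
    ne_eq, not_true_eq_false, if_false, zero_add]
  rfl

theorem wt_eq_hammingNorm (x : F ι) : wt x = (hammingNorm x : ZMod 2) := by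
  rw [wt, hammingNorm, Finset.card_filter, Nat.cast_sum]
  refine Finset.sum_congr rfl fun i _ => ?_
  generalize x i = t
  revert t
  decide

variable [DecidableEq ι]

theorem hammingNorm_update_zero_add_one {x : F ι} {i : ι} (hi : x i ≠ 0) :
    hammingNorm (Function.update x i 0) + 1 = hammingNorm x := by
  have h : ({k | Function.update x i 0 k ≠ 0} : Finset ι) =
      ({k | x k ≠ 0} : Finset ι).erase i := by
    ext k
    by_cases hk : k = i <;> simp [Function.update_apply, hk]
  rw [hammingNorm, h, Finset.card_erase_add_one (by simpa using hi), hammingNorm]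

theorem hammingNorm_single_one (i : ι) : hammingNorm (Pi.single i 1 : F ι) = 1 := by
  simp [hammingNorm, Pi.single_apply, Finset.filter_eq']

theorem single_add_update_zero {x : F ι} {i : ι} (hi : x i ≠ 0) :
    Pi.single i 1 + Function.update x i 0 = x := by
  have h1 : x i = 1 := by
    generalize x i = t at hi
    revert t
    decide
  ext k
  by_cases hk : k = i
  · subst hk
    simp [h1]
  · simp [hk]

/-- A lift of every generator of the `i`-component along `vasProj` lifts the whole component. -/
theorem component_subset_image {C : Set (F ι)} {i : ι} {C' : Set (F (ι ⊕ Unit ⊕ ι))}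
    {i' : ι ⊕ Unit ⊕ ι}
    (h : ∀ y ∈ C, hammingNorm y = 3 → y i ≠ 0 →
      ∃ z ∈ C', hammingNorm z = 3 ∧ z i' ≠ 0 ∧ vasProj ι z = y) :
    component C i ⊆ vasProj ι '' component C' i' := by
  rw [component, component, ← Submodule.map_coe, SetLike.coe_subset_coe, Submodule.span_le]
  rintro y ⟨hy, hy3, hyi⟩
  obtain ⟨z, hz, hz3, hzi, rfl⟩ := h y hy hy3 hyi
  exact Submodule.mem_map_of_mem (Submodule.subset_span ⟨hz, hz3, hzi⟩)

theorem component_subset_image_inl (C : Set (F ι)) (i : ι) :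
    component C i ⊆ vasProj ι '' component (Vasiliev C 0) (Sum.inl i) := by
  refine component_subset_image fun y hy hy3 hyi =>
    ⟨vasVec y 0 0, ⟨0, y, hy, by simp [wt]⟩, ?_, hyi, by rw [vasProj_vasVec, add_zero]⟩
  rw [hammingNorm_vasVec_zero, hy3, hammingNorm_zero]

theorem component_subset_image_inr (C : Set (F ι)) (i : ι) :
    component C i ⊆ vasProj ι '' component (Vasiliev C 0) (Sum.inr (Sum.inr i)) := by
  refine component_subset_image fun y hy hy3 hyi => ?_
  obtain ⟨b, hb, hbi⟩ : ∃ b, y b ≠ 0 ∧ b ≠ i := by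
    obtain ⟨b, hb, hbi⟩ := Finset.exists_mem_ne
      (show 1 < ({k | y k ≠ 0} : Finset ι).card by rw [← hammingNorm, hy3]; norm_num) i
    exact ⟨b, by simpa using hb, hbi⟩
  have hnorm : hammingNorm (Function.update y b 0) = 2 := by
    have := hammingNorm_update_zero_add_one hb
    omega
  have hsum := single_add_update_zero hb
  refine ⟨vasVec (Pi.single b 1) 0 (Function.update y b 0),
    ⟨Function.update y b 0, y, hy, ?_⟩, ?_, ?_, ?_⟩
  · have hx : Function.update y b 0 + y = Pi.single b 1 := by
      nth_rewrite 2 [← hsum]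
      rw [add_left_comm]
      ext k
      simp only [Pi.add_apply, CharTwo.add_self_eq_zero, add_zero]
    have hwt : wt (Function.update y b 0) = 0 := by
      rw [wt_eq_hammingNorm, hnorm]
      rfl
    rw [hx, hwt, Pi.zero_apply, add_zero]
  · rw [hammingNorm_vasVec_zero, hammingNorm_single_one, hnorm]
  · change Function.update y b 0 i ≠ 0
    rwa [Function.update_of_ne hbi.symm]
  · rw [vasProj_vasVec, hsum]

end Projection

/-- STATEMENT 14: if `λ_m` pierces `R_j^m` then `λ_{2m+1}` pierces both `R_j^{2m+1}`
and `R_{j+m+1}^{2m+1}`. -/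
theorem stmt14 {n : ℕ} (H : Set (F (Fin n))) (hH : IsHammingCode H)
    (lam : F (Fin n) → ZMod 2) (hlam : lam 0 = 0) (s : ℕ) (j : HType n s)
    (hp : Pierces (lamIter n lam s) (component (Hcode n H s) j)) :
    Pierces (lamIter n lam (s + 1)) (component (Hcode n H (s + 1)) (Sum.inl j)) ∧
    Pierces (lamIter n lam (s + 1))
      (component (Hcode n H (s + 1)) (Sum.inr (Sum.inr j))) := by
  have hinl := component_subset_image_inl (Hcode n H s) j
  have hinr := component_subset_image_inr (Hcode n H s) j
  exact ⟨hp.lamSucc hinl, hp.lamSucc hinr⟩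
end

section
/- For any Vasil'ev code V_C^λ, the subspace R_{n+1}^{2n+1} = {(x, |x|, x) : x ∈ F^n} is contained in Ker(V_C^λ), i.e., v + V_C^λ = V_C^λ for every v ∈ R_{n+1}^{2n+1}. -/
set_option linter.unusedSectionVars false

theorem wt_add {ι : Type*} [Fintype ι] (x y : F ι) : wt (x + y) = wt x + wt y := by
  simp [wt, Finset.sum_add_distrib]

theorem vasVec_add {ι : Type*} (a a' : F ι) (b b' : ZMod 2) (c c' : F ι) :
    vasVec a b c + vasVec a' b' c' = vasVec (a + a') (b + b') (c + c') := by
  ext i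
  rcases i with i | i | i <;> rfl

theorem add_mem_vasiliev {ι : Type*} [Fintype ι] [DecidableEq ι] {C : Set (F ι)}
    {lam : F ι → ZMod 2} {v w : F (ι ⊕ Unit ⊕ ι)} (hv : v ∈ Rmid)
    (hw : w ∈ Vasiliev C lam) : v + w ∈ Vasiliev C lam := by
  obtain ⟨x, rfl⟩ := hv
  obtain ⟨z, y, hy, rfl⟩ := hw
  exact ⟨x + z, y, hy, by rw [vasVec_add, wt_add, add_assoc, add_assoc]⟩

theorem rmid_subset_vasiliev {ι : Type*} [Fintype ι] [DecidableEq ι] {C : Set (F ι)}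
    {lam : F ι → ZMod 2} (h0 : (0 : F ι) ∈ C) (hlam : lam 0 = 0) :
    Rmid ⊆ Vasiliev C lam := by
  rintro _ ⟨x, rfl⟩
  exact ⟨x, 0, h0, by rw [hlam, add_zero, add_zero]⟩

/-- STATEMENT 17: `R_{n+1}^{2n+1} ⊆ Ker(V_C^λ)`. -/
theorem stmt17 {n : ℕ} (C : Set (F (Fin n))) (h0 : (0 : F (Fin n)) ∈ C)
    (hC : IsPerfect C) (lam : F (Fin n) → ZMod 2) (hlam : lam 0 = 0) :
    Rmid ⊆ KerSet (Vasiliev C lam) := by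
  intro v hv
  refine ⟨rmid_subset_vasiliev h0 hlam hv, Set.Subset.antisymm ?_ fun w hw => ?_⟩
  · rintro _ ⟨w, hw, rfl⟩
    exact add_mem_vasiliev hv hw
  · refine ⟨v + w, add_mem_vasiliev hv hw, ?_⟩
    change v + (v + w) = w
    rw [← add_assoc, CharTwo.add_self_eq_zero, zero_add]
end

section
/- Let V = V_C^λ be a Vasil'ev code of length 2n+1. For every z ∈ V and every v ∈ R_{n+1}^{2n+1}: STS(V, z+v) = STS(V, z), and z ∈ Tr(V) if and only if z+v ∈ Tr(V). -/
set_option linter.unusedSectionVars false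

theorem add_self_eq_zero_of_binary {ι : Type*} (v : F ι) : v + v = 0 :=
  funext fun i => CharTwo.add_self_eq_zero (v i)

theorem add_add_self {ι : Type*} (x v : F ι) : x + v + v = x := by
  rw [add_assoc, add_self_eq_zero_of_binary, add_zero]

theorem add_mem_Vasiliev {ι : Type*} [Fintype ι] {C : Set (F ι)} {lam : F ι → ZMod 2}
    {z v : F (ι ⊕ Unit ⊕ ι)} (hz : z ∈ Vasiliev C lam) (hv : v ∈ Rmid) :
    z + v ∈ Vasiliev C lam := by
  obtain ⟨x, y, hy, rfl⟩ := hz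
  obtain ⟨u, rfl⟩ := hv
  refine ⟨x + u, y, hy, ?_⟩
  rw [vasVec_add, wt_add, add_right_comm x y u, add_right_comm (wt x) (lam y)]

theorem STS_subset_STS_add {ι : Type*} [Fintype ι] [DecidableEq ι] {V : Set (F ι)} {v : F ι}
    (hV : ∀ x ∈ V, x + v ∈ V) (z : F ι) : STS V z ⊆ STS V (z + v) := by
  rintro s ⟨x, hx, hd, rfl⟩
  refine ⟨x + v, hV x hx, ?_, ?_⟩
  · rw [← hd]
    simp [hammingDist]
  · rw [add_add_add_comm, add_self_eq_zero_of_binary, add_zero]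

theorem translateCode_add {ι : Type*} (z v : F ι) (D : Set (F ι)) :
    translateCode (z + v) D = (· + v) '' translateCode z D := by
  simp only [translateCode, Set.image_image, add_right_comm]

theorem image_add_right_eq {ι : Type*} {V : Set (F ι)} {v : F ι}
    (hV : ∀ x ∈ V, x + v ∈ V) : (· + v) '' V = V :=
  (Set.image_subset_iff.2 hV).antisymm fun x hx => ⟨x + v, hV x hx, add_add_self x v⟩

theorem add_mem_TrSet {ι : Type*} {V : Set (F ι)} {v : F ι}
    (hV : ∀ x ∈ V, x + v ∈ V) {z : F ι} (hz : z ∈ TrSet V) : z + v ∈ TrSet V := by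
  obtain ⟨hzV, π, hπ⟩ := hz
  exact ⟨hV z hzV, π, by rw [translateCode_add, hπ, image_add_right_eq hV]⟩

/-- STATEMENT 18: translating a codeword of a Vasil'ev code by an element of
`R_{n+1}^{2n+1}` changes neither its Steiner triple system nor its membership in `Tr`. -/
theorem stmt18 {n : ℕ} (C : Set (F (Fin n))) (h0 : (0 : F (Fin n)) ∈ C)
    (hC : IsPerfect C) (lam : F (Fin n) → ZMod 2) (hlam : lam 0 = 0)
    (z : F (Fin n ⊕ Unit ⊕ Fin n)) (hz : z ∈ Vasiliev C lam)
    (v : F (Fin n ⊕ Unit ⊕ Fin n)) (hv : v ∈ Rmid) :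
    STS (Vasiliev C lam) (z + v) = STS (Vasiliev C lam) z ∧
    (z ∈ TrSet (Vasiliev C lam) ↔ z + v ∈ TrSet (Vasiliev C lam)) := by
  have hV : ∀ x ∈ Vasiliev C lam, x + v ∈ Vasiliev C lam := fun x hx => add_mem_Vasiliev hx hv
  refine ⟨Set.Subset.antisymm ?_ (STS_subset_STS_add hV z), add_mem_TrSet hV, fun h => ?_⟩
  · simpa only [add_add_self] using STS_subset_STS_add hV (z + v)
  · simpa only [add_add_self] using add_mem_TrSet hV h
end

section
/- Let S be a Steiner triple system of order 7, and let θ, θ': S → {0,1} be functions such that the number of triples on which θ takes value 0 and the number of triples on which θ' takes value 0 both belong to {1, 2, 5, 6}. Then the Assmus–Mattson systems S^θ and S^{θ'} are isomorphic Steiner triple systems of order 15. -/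
set_option linter.unusedSectionVars false

section AssmusMattson

variable {ι : Type*}

/-- The point of `ι ⊕ Unit ⊕ ι` over `a` on the level `b`: `a` if `b = 0`, and `a + n + 1`
otherwise. -/
def levelPoint (a : ι) (b : ZMod 2) : ι ⊕ Unit ⊕ ι :=
  if b = 0 then Sum.inl a else Sum.inr (Sum.inr a)

@[simp] theorem levelPoint_zero (a : ι) : levelPoint a 0 = Sum.inl a := rfl

@[simp] theorem levelPoint_one (a : ι) : levelPoint a 1 = Sum.inr (Sum.inr a) := rfl

theorem zmod_two_cases (b : ZMod 2) : b = 0 ∨ b = 1 := by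
  revert b
  decide

@[simp] theorem levelPoint_inj {a a' : ι} {b b' : ZMod 2} :
    levelPoint a b = levelPoint a' b' ↔ a = a' ∧ b = b' := by
  rcases zmod_two_cases b with rfl | rfl <;> rcases zmod_two_cases b' with rfl | rfl <;> simp

@[simp] theorem levelPoint_ne_center (a : ι) (b : ZMod 2) (z : Unit) :
    levelPoint a b ≠ Sum.inr (Sum.inl z) := by
  rcases zmod_two_cases b with rfl | rfl <;> simp

theorem eq_center_or_levelPoint (x : ι ⊕ Unit ⊕ ι) :
    x = Sum.inr (Sum.inl ()) ∨ ∃ a b, x = levelPoint a b := by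
  rcases x with a | _ | a
  · exact Or.inr ⟨a, 0, rfl⟩
  · exact Or.inl rfl
  · exact Or.inr ⟨a, 1, rfl⟩

theorem tau_levelPoint [Fintype ι] [DecidableEq ι] (u : F ι) (a : ι) (b : ZMod 2) :
    tau u (levelPoint a b) = levelPoint a (b + u a) := by
  rcases zmod_two_cases b with rfl | rfl <;> rcases zmod_two_cases (u a) with h | h <;>
    simp [tau, tauFun, h, CharTwo.add_self_eq_zero]

theorem dup_levelPoint (σ : Equiv.Perm ι) (a : ι) (b : ZMod 2) :
    dup σ (levelPoint a b) = levelPoint (σ a) b := by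
  rcases zmod_two_cases b with rfl | rfl <;> simp [dup]

/-- The triple `{i, n + 1, i + n + 1}` of an Assmus–Mattson system. -/
def spoke (i : ι) : Set (ι ⊕ Unit ⊕ ι) :=
  {Sum.inl i, Sum.inr (Sum.inl ()), Sum.inr (Sum.inr i)}

@[simp] theorem center_mem_spoke (i : ι) : Sum.inr (Sum.inl ()) ∈ spoke i := by
  simp [spoke]

@[simp] theorem levelPoint_mem_spoke {a i : ι} {b : ZMod 2} :
    levelPoint a b ∈ spoke i ↔ a = i := by
  rcases zmod_two_cases b with rfl | rfl <;> simp [spoke]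

theorem ncard_spoke (i : ι) : (spoke i).ncard = 3 :=
  Set.ncard_eq_three.2 ⟨_, _, _, by simp, by simp, by simp, rfl⟩

/-- The set of the points over `s` on the levels given by `f`. -/
def lift (f : F ι) (s : Set ι) : Set (ι ⊕ Unit ⊕ ι) := (fun a => levelPoint a (f a)) '' s

@[simp] theorem levelPoint_mem_lift {f : F ι} {s : Set ι} {a : ι} {b : ZMod 2} :
    levelPoint a b ∈ lift f s ↔ a ∈ s ∧ f a = b := by
  simp [lift]

@[simp] theorem center_notMem_lift (f : F ι) (s : Set ι) (z : Unit) :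
    Sum.inr (Sum.inl z) ∉ lift f s := by
  simp [lift]

theorem ncard_lift (f : F ι) (s : Set ι) : (lift f s).ncard = s.ncard :=
  Set.ncard_image_of_injective _ fun _ _ h => (levelPoint_inj.1 h).1

theorem finsum_mem_triple {M : Type*} [AddCommMonoid M] (f : ι → M) {a b c : ι} (hab : a ≠ b)
    (hac : a ≠ c) (hbc : b ≠ c) : ∑ᶠ x ∈ ({a, b, c} : Set ι), f x = f a + (f b + f c) := by
  rw [finsum_mem_insert _ (by simp [hab, hac]) (Set.toFinite _), finsum_mem_pair hbc]

/-- The triples of `S^θ` other than the spokes are the lifts of the triples `s ∈ S` whose levels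
sum up to `θ s`. -/
theorem mem_AM_iff {S : Set (Set ι)} (hS : ∀ s ∈ S, s.ncard = 3) {θ : Set ι → ZMod 2}
    {T : Set (ι ⊕ Unit ⊕ ι)} :
    T ∈ AM S θ ↔ (∃ i, T = spoke i) ∨
      ∃ s ∈ S, ∃ f : F ι, ∑ᶠ a ∈ s, f a = θ s ∧ T = lift f s := by
  have sum_eq : ∀ p q r c : ZMod 2, p + (q + r) = c → ¬ (p = c ∧ q = c ∧ r = c) →
      (p = c ∧ q = c + 1 ∧ r = c + 1) ∨ (q = c ∧ p = c + 1 ∧ r = c + 1) ∨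
      (r = c ∧ p = c + 1 ∧ q = c + 1) := by
    rintro p q r _ rfl
    revert p q r
    decide
  classical
  have lift_update : ∀ (s : Set ι) (a : ι) (b c : ZMod 2), a ∈ s →
      lift (Function.update (fun _ => b) a c) s =
        insert (levelPoint a c) ((fun i => levelPoint i b) '' (s \ {a})) := by
    intro s a b c ha
    ext x
    simp only [lift, Set.mem_image, Set.mem_insert_iff, Set.mem_sdiff, Set.mem_singleton_iff]
    constructor
    · rintro ⟨i, hi, rfl⟩
      by_cases h : i = a
      · subst h; simp
      · right; exact ⟨i, ⟨hi, h⟩, by simp [h]⟩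
    · rintro (rfl | ⟨i, ⟨hi, h⟩, rfl⟩)
      · exact ⟨a, ha, by simp⟩
      · exact ⟨i, hi, by simp [h]⟩
  have sum_const : ∀ s ∈ S, ∀ b : ZMod 2, ∑ᶠ _ ∈ s, b = b := by
    intro s hs b
    obtain ⟨x, y, z, hxy, hxz, hyz, rfl⟩ := Set.ncard_eq_three.1 (hS s hs)
    rw [finsum_mem_triple _ hxy hxz hyz, CharTwo.add_self_eq_zero, add_zero]
  have sum_update : ∀ s ∈ S, ∀ a ∈ s, ∀ b c : ZMod 2,
      ∑ᶠ i ∈ s, Function.update (fun _ => b) a c i = c := by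
    intro s hs a ha b c
    obtain ⟨x, y, z, hxy, hxz, hyz, rfl⟩ := Set.ncard_eq_three.1 (hS s hs)
    rw [finsum_mem_triple _ hxy hxz hyz]
    have := CharTwo.add_self_eq_zero b
    rcases ha with rfl | rfl | rfl
    · simp [hxy.symm, hxz.symm, this]
    · rw [add_left_comm]; simp [hxy, hyz.symm, this]
    · rw [← add_assoc]; simp [hxz, hyz, this]
  have key : ∀ s ∈ S, ∀ c, θ s = c →
      ((T = (fun i => levelPoint i c) '' s ∨
        ∃ a ∈ s, T = insert (levelPoint a c) ((fun i => levelPoint i (c + 1)) '' (s \ {a}))) ↔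
      ∃ f : F ι, ∑ᶠ a ∈ s, f a = θ s ∧ T = lift f s) := by
    intro s hs c hc
    constructor
    · rintro (rfl | ⟨a, ha, rfl⟩)
      · exact ⟨fun _ => c, by rw [sum_const s hs, hc], rfl⟩
      · exact ⟨_, by rw [sum_update s hs a ha (c + 1) c, hc], (lift_update s a _ _ ha).symm⟩
    · rintro ⟨f, hf, rfl⟩
      by_cases hall : ∀ i ∈ s, f i = c
      · left
        exact Set.image_congr fun i hi => by rw [hall i hi]
      · right
        obtain ⟨a, ha, hfa, hother⟩ : ∃ a ∈ s, f a = c ∧ ∀ i ∈ s, i ≠ a → f i = c + 1 := by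
          obtain ⟨x, y, z, hxy, hxz, hyz, rfl⟩ := Set.ncard_eq_three.1 (hS s hs)
          rw [finsum_mem_triple _ hxy hxz hyz, hc] at hf
          simp only [Set.mem_insert_iff, Set.mem_singleton_iff, forall_eq_or_imp, forall_eq,
            exists_eq_or_imp, exists_eq_left] at hall ⊢
          generalize f x = p at *
          generalize f y = q at *
          generalize f z = r at *
          have := sum_eq p q r c hf hall
          tauto
        refine ⟨a, ha, ?_⟩
        rw [← lift_update s a _ _ ha]
        refine Set.image_congr fun i hi => ?_
        by_cases h : i = a
        · subst h; simp [hfa]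
        · simp [h, hother i hi h]
  have h10 : (1 : ZMod 2) + 1 = 0 := rfl
  constructor
  · rintro (⟨i, hi⟩ | ⟨s, hs, hc, h⟩ | ⟨s, hs, hc, h⟩)
    · exact Or.inl ⟨i, hi⟩
    · exact Or.inr ⟨s, hs, (key s hs 0 hc).1 h⟩
    · exact Or.inr ⟨s, hs, (key s hs 1 hc).1 (by simpa [h10] using h)⟩
  · rintro (⟨i, hi⟩ | ⟨s, hs, h⟩)
    · exact Or.inl ⟨i, hi⟩
    · rcases zmod_two_cases (θ s) with hc | hc
      · exact Or.inr (Or.inl ⟨s, hs, hc, (key s hs 0 hc).2 h⟩)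
      · exact Or.inr (Or.inr ⟨s, hs, hc, by simpa [h10] using (key s hs 1 hc).2 h⟩)

theorem IsSTS.exists_third {α : Type*} {S : Set (Set α)} (hS : IsSTS S) {i j : α} (hij : i ≠ j) :
    ∃ k, i ≠ k ∧ j ≠ k ∧ {i, j, k} ∈ S := by
  obtain ⟨s, ⟨hs, hi, hj⟩, -⟩ := hS.2 i j hij
  obtain ⟨x, y, z, hxy, hxz, hyz, rfl⟩ := Set.ncard_eq_three.1 (hS.1 s hs)
  have hsub : ({i, j} : Set α) ⊆ {x, y, z} := by
    rintro _ (rfl | rfl) <;> assumption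
  obtain ⟨k, hk⟩ : ∃ k, ({x, y, z} : Set α) \ {i, j} = {k} := by
    rw [← Set.ncard_eq_one, Set.ncard_sdiff hsub, hS.1 _ hs, Set.ncard_pair hij]
  have hk' : k ∈ ({x, y, z} : Set α) \ {i, j} := hk ▸ rfl
  refine ⟨k, ?_, ?_, ?_⟩
  · rintro rfl; simp at hk'
  · rintro rfl; simp at hk'
  · rwa [show ({i, j, k} : Set α) = {x, y, z} by
      rw [← Set.sdiff_union_of_subset hsub, hk]; ext; simp]

/-- A Steiner triple system contained in another one is equal to it. -/
theorem IsSTS.eq_of_subset {α : Type*} {S S' : Set (Set α)} (hS : IsSTS S) (hS' : IsSTS S')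
    (h : S ⊆ S') : S = S' := by
  refine h.antisymm fun s hs => ?_
  obtain ⟨x, y, z, hxy, -, -, rfl⟩ := Set.ncard_eq_three.1 (hS'.1 s hs)
  obtain ⟨t, ⟨ht, hx, hy⟩, -⟩ := hS.2 x y hxy
  rwa [(hS'.2 x y hxy).unique ⟨hs, by simp, by simp⟩ ⟨h ht, hx, hy⟩]

theorem IsSTS.image {α β : Type*} {S : Set (Set α)} (hS : IsSTS S) (e : α ≃ β) :
    IsSTS (Set.image e '' S) := by
  constructor
  · rintro _ ⟨s, hs, rfl⟩
    rw [Set.ncard_image_of_injective _ e.injective, hS.1 s hs]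
  · intro i j hij
    obtain ⟨s, ⟨hs, hi, hj⟩, huniq⟩ := hS.2 (e.symm i) (e.symm j) (by simpa using hij)
    refine ⟨e '' s, ⟨⟨s, hs, rfl⟩, ⟨_, hi, by simp⟩, ⟨_, hj, by simp⟩⟩, ?_⟩
    rintro _ ⟨⟨t, ht, rfl⟩, ⟨i', hi', rfl⟩, ⟨j', hj', rfl⟩⟩
    rw [huniq t ⟨ht, by simpa using hi', by simpa using hj'⟩]

/-- The Assmus–Mattson construction yields Steiner triple systems. -/
theorem IsSTS.AM {S : Set (Set ι)} (hS : IsSTS S) (θ : Set ι → ZMod 2) : IsSTS (AM S θ) := by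
  classical
  constructor
  · intro T hT
    rcases (mem_AM_iff hS.1).1 hT with ⟨i, rfl⟩ | ⟨s, hs, f, -, rfl⟩
    · exact ncard_spoke i
    · rw [ncard_lift, hS.1 s hs]
  · have center : ∀ a b, ∃! T, T ∈ _root_.AM S θ ∧ Sum.inr (Sum.inl ()) ∈ T ∧
        levelPoint a b ∈ T := by
      intro a b
      refine ⟨spoke a, ⟨(mem_AM_iff hS.1).2 (Or.inl ⟨a, rfl⟩), by simp, by simp⟩, ?_⟩
      rintro T ⟨hT, hc, ha⟩
      rcases (mem_AM_iff hS.1).1 hT with ⟨i, rfl⟩ | ⟨s, hs, f, -, rfl⟩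
      · rw [levelPoint_mem_spoke.1 ha]
      · simp at hc
    intro x y hxy
    rcases eq_center_or_levelPoint x with rfl | ⟨i, b, rfl⟩
    · rcases eq_center_or_levelPoint y with rfl | ⟨j, c, rfl⟩
      · exact absurd rfl hxy
      · exact center j c
    rcases eq_center_or_levelPoint y with rfl | ⟨j, c, rfl⟩
    · simpa only [and_comm (a := levelPoint i b ∈ _)] using center i b
    by_cases hij : i = j
    · subst hij
      have hbc : b ≠ c := fun h => hxy (by rw [h])
      refine ⟨spoke i, ⟨(mem_AM_iff hS.1).2 (Or.inl ⟨i, rfl⟩), by simp, by simp⟩, ?_⟩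
      rintro T ⟨hT, hi, hj⟩
      rcases (mem_AM_iff hS.1).1 hT with ⟨k, rfl⟩ | ⟨s, hs, f, -, rfl⟩
      · rw [levelPoint_mem_spoke.1 hi]
      · rw [levelPoint_mem_lift] at hi hj
        exact absurd (hi.2.symm.trans hj.2) hbc
    · obtain ⟨k, hik, hjk, hs⟩ := hS.exists_third hij
      set s : Set ι := {i, j, k} with hsdef
      have sum_eq (f : F ι) : ∑ᶠ a ∈ s, f a = f i + (f j + f k) :=
        finsum_mem_triple f hij hik hjk
      let f : F ι := fun a => if a = i then b else if a = j then c else θ s - c - b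
      have fi : f i = b := by simp [f]
      have fj : f j = c := by simp [f, Ne.symm hij]
      have fk : f k = θ s - c - b := by simp [f, hik.symm, hjk.symm]
      refine ⟨lift f s, ⟨(mem_AM_iff hS.1).2 (Or.inr ⟨s, hs, f, ?_, rfl⟩), ?_, ?_⟩, ?_⟩
      · rw [sum_eq, fi, fj, fk]; ring
      · simp [fi, hsdef]
      · simp [fj, hsdef]
      rintro T ⟨hT, hi, hj⟩
      rcases (mem_AM_iff hS.1).1 hT with ⟨l, rfl⟩ | ⟨t, ht, g, hg, rfl⟩
      · rw [levelPoint_mem_spoke] at hi hj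
        exact absurd (hi.trans hj.symm) hij
      · rw [levelPoint_mem_lift] at hi hj
        obtain rfl : t = s :=
          (hS.2 i j hij).unique ⟨ht, hi.1, hj.1⟩ ⟨hs, by simp [hsdef], by simp [hsdef]⟩
        refine Set.image_congr ?_
        have gk : g k = f k := by
          rw [fk, ← hg, sum_eq, hi.2, hj.2]; ring
        rintro a (rfl | rfl | rfl)
        · rw [hi.2, fi]
        · rw [hj.2, fj]
        · rw [gk]

/-- Relabelling `S` by `σ` and adding to `θ` the function `s ↦ ∑ a ∈ s, u a` gives an isomorphic
Assmus–Mattson system. -/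
theorem image_dup_mul_tau_AM [Fintype ι] [DecidableEq ι] {S : Set (Set ι)} (hS : IsSTS S) {θ θ' : Set ι → ZMod 2}
    (σ : Equiv.Perm ι) (u : F ι) (h : ∀ s ∈ S, θ' (σ '' s) = θ s + ∑ᶠ a ∈ s, u a) :
    Set.image (dup σ * tau u) '' AM S θ = AM (Set.image σ '' S) θ' := by
  refine IsSTS.eq_of_subset ((hS.AM θ).image _) ((hS.image σ).AM θ') ?_
  rintro _ ⟨T, hT, rfl⟩
  rw [mem_AM_iff (hS.image σ).1]
  rcases (mem_AM_iff hS.1).1 hT with ⟨i, rfl⟩ | ⟨s, hs, f, hf, rfl⟩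
  · left
    refine ⟨σ i, ?_⟩
    rcases zmod_two_cases (u i) with hu | hu <;>
      simp [spoke, Set.image_insert_eq, dup, tau, tauFun, hu]
    rw [Set.insert_comm, Set.pair_comm, Set.insert_comm]
  · right
    refine ⟨σ '' s, ⟨s, hs, rfl⟩, (f + u) ∘ σ.symm, ?_, ?_⟩
    · rw [finsum_mem_image σ.injective.injOn, h s hs, ← hf]
      simpa using finsum_mem_add_distrib
        (Set.finite_of_ncard_ne_zero (by rw [hS.1 s hs]; decide))
    · simp [lift, Set.image_image, tau_levelPoint, dup_levelPoint]

end AssmusMattson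

section Fano

/-- The lines of the Fano plane on `Fin 7`, as translates of the difference set `{0, 1, 3}`. -/
def fanoLine (j : Fin 7) : Set (Fin 7) := {j, j + 1, j + 3}

theorem isSTS_range_fanoLine : IsSTS (Set.range fanoLine) := by
  constructor
  · rintro _ ⟨j, rfl⟩
    exact Set.ncard_eq_three.2 ⟨_, _, _, by revert j; decide, by revert j; decide,
      by revert j; decide, rfl⟩
  · intro i j hij
    have h : ∀ i j : Fin 7, i ≠ j → ∃ k : Fin 7, ((i = k ∨ i = k + 1 ∨ i = k + 3) ∧
        (j = k ∨ j = k + 1 ∨ j = k + 3)) ∧ ∀ l : Fin 7, (i = l ∨ i = l + 1 ∨ i = l + 3) ∧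
        (j = l ∨ j = l + 1 ∨ j = l + 3) → l = k := by decide
    obtain ⟨k, hk, huniq⟩ := h i j hij
    refine ⟨fanoLine k, ⟨⟨k, rfl⟩, hk⟩, ?_⟩
    rintro _ ⟨⟨l, rfl⟩, hl⟩
    rw [huniq l hl]

theorem fanoLine_injective : Function.Injective fanoLine := by
  intro i j hij
  have hi : i ∈ fanoLine j := hij ▸ Or.inl rfl
  have hi' : i + 1 ∈ fanoLine j := hij ▸ Or.inr (Or.inl rfl)
  have h : ∀ i j : Fin 7, (i = j ∨ i = j + 1 ∨ i = j + 3) →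
      (i + 1 = j ∨ i + 1 = j + 1 ∨ i + 1 = j + 3) → i = j := by decide
  exact h i j hi hi'

/-- Every Steiner triple system of order 7 is isomorphic to the Fano plane. -/
theorem IsSTS.exists_eq_image_fanoLine {S : Set (Set (Fin 7))} (hS : IsSTS S) :
    ∃ σ : Equiv.Perm (Fin 7), S = Set.image σ '' Set.range fanoLine := by
  have third {i j : Fin 7} (hij : i ≠ j) := hS.exists_third hij
  have uniq {i j k l : Fin 7} (hij : i ≠ j) (hk : {i, j, k} ∈ S) (hik : i ≠ k) (hjk : j ≠ k)
      (hl : {i, j, l} ∈ S) : k = l := by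
    have h := (hS.2 i j hij).unique ⟨hk, by simp, by simp⟩ ⟨hl, by simp, by simp⟩
    have hk' : k ∈ ({i, j, l} : Set (Fin 7)) := h ▸ by simp
    simpa [hik.symm, hjk.symm] using hk'
  have swap {i j k : Fin 7} (h : {i, j, k} ∈ S) : {j, i, k} ∈ S := by
    rwa [Set.insert_comm]
  have rot {i j k : Fin 7} (h : {i, j, k} ∈ S) : {i, k, j} ∈ S := by
    rwa [Set.pair_comm]
  obtain ⟨a, b, hab⟩ : ∃ a b : Fin 7, a ≠ b := ⟨0, 1, by decide⟩
  obtain ⟨c, hac, hbc, habc⟩ := third hab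
  obtain ⟨d, had, hbd, hcd⟩ : ∃ d, a ≠ d ∧ b ≠ d ∧ c ≠ d := by
    have h : ∀ a b c : Fin 7, ∃ d, a ≠ d ∧ b ≠ d ∧ c ≠ d := by decide +kernel
    exact h a b c
  obtain ⟨e, hae, hde, hade⟩ := third had
  obtain ⟨f, hbf, hdf, hbdf⟩ := third hbd
  obtain ⟨g, hcg, hdg, hcdg⟩ := third hcd
  have hbe : b ≠ e := by grind
  have hce : c ≠ e := by grind
  have haf : a ≠ f := by grind
  have hcf : c ≠ f := by grind
  have hag : a ≠ g := by grind
  have hbg : b ≠ g := by grind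
  have hef : e ≠ f := by grind
  have heg : e ≠ g := by grind
  have hfg : f ≠ g := by grind
  have hinj : Function.Injective ![a, b, d, c, f, g, e] := by
    intro i j
    fin_cases i <;> fin_cases j <;> simp <;> grind
  let σ : Equiv.Perm (Fin 7) := Equiv.ofBijective _ (Finite.injective_iff_bijective.1 hinj)
  have cover (x : Fin 7) : x = a ∨ x = b ∨ x = d ∨ x = c ∨ x = f ∨ x = g ∨ x = e := by
    obtain ⟨i, rfl⟩ := σ.surjective x
    fin_cases i <;> simp [σ]
  have hafg : {a, f, g} ∈ S := by
    obtain ⟨x, hax, hfx, hx⟩ := third haf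
    rcases cover x with rfl | rfl | rfl | rfl | rfl | rfl | rfl <;> grind
  have hbeg : {b, e, g} ∈ S := by
    obtain ⟨x, hax, hfx, hx⟩ := third hbe
    rcases cover x with rfl | rfl | rfl | rfl | rfl | rfl | rfl <;> grind
  have hcef : {c, e, f} ∈ S := by
    obtain ⟨x, hax, hfx, hx⟩ := third hce
    rcases cover x with rfl | rfl | rfl | rfl | rfl | rfl | rfl <;> grind
  refine ⟨σ, (IsSTS.eq_of_subset (isSTS_range_fanoLine.image σ) hS ?_).symm⟩
  rintro _ ⟨_, ⟨j, rfl⟩, rfl⟩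
  fin_cases j <;> simp [fanoLine, Set.image_insert_eq, σ] <;> grind

/-- A function on the lines of the Fano plane with 1, 2, 5 or 6 zeros is not in the Hamming code
spanned by the points, hence it differs from a codeword in exactly one line. -/
theorem exists_add_eq_single (g : Fin 7 → ZMod 2)
    (hg : {j | g j = 0}.ncard ∈ ({1, 2, 5, 6} : Set ℕ)) :
    ∃ (u : F (Fin 7)) (i : Fin 7), ∀ j,
      g j + (u j + (u (j + 1) + u (j + 3))) = if j = i then 1 else 0 := by
  rw [Set.ncard_eq_toFinset_card', Set.toFinset_ofPred] at hg
  simp only [Set.mem_insert_iff, Set.mem_singleton_iff] at hg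
  revert g
  decide +kernel

/-- The Assmus–Mattson systems over an STS(7) with 1, 2, 5 or 6 zeros have a common normal form:
the one over the Fano plane with a single nonzero line. -/
theorem exists_image_AM_eq {S : Set (Set (Fin 7))} (hS : IsSTS S) {θ : Set (Fin 7) → ZMod 2}
    (hθ : {s ∈ S | θ s = 0}.ncard ∈ ({1, 2, 5, 6} : Set ℕ)) :
    ∃ π : Equiv.Perm (Fin 7 ⊕ Unit ⊕ Fin 7), Set.image π '' AM S θ =
      AM (Set.range fanoLine) (fun s => open Classical in if s = fanoLine 0 then 1 else 0) := by
  classical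
  obtain ⟨σ, rfl⟩ := hS.exists_eq_image_fanoLine
  have hzeros : {s ∈ Set.image σ '' Set.range fanoLine | θ s = 0} =
      (fun j => σ '' fanoLine j) '' {j | θ (σ '' fanoLine j) = 0} := by
    ext s
    constructor
    · rintro ⟨⟨_, ⟨j, rfl⟩, rfl⟩, h⟩
      exact ⟨j, h, rfl⟩
    · rintro ⟨j, h, rfl⟩
      exact ⟨⟨_, ⟨j, rfl⟩, rfl⟩, h⟩
  have hinj : Function.Injective fun j => σ '' fanoLine j :=
    σ.injective.image_injective.comp fanoLine_injective
  rw [hzeros, Set.ncard_image_of_injective _ hinj] at hθ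
  obtain ⟨u, i, hu⟩ := exists_add_eq_single _ hθ
  have shift (j : Fin 7) : Equiv.subRight i '' fanoLine j = fanoLine (j - i) := by
    simp only [fanoLine, Set.image_insert_eq, Set.image_singleton, Equiv.subRight_apply]
    rw [sub_add_eq_add_sub, sub_add_eq_add_sub]
  have himage : Set.image (σ.symm.trans (Equiv.subRight i)) ''
      (Set.image σ '' Set.range fanoLine) = Set.range fanoLine := by
    ext s
    simp only [Set.mem_image, Set.mem_range, exists_exists_eq_and, Set.image_image,
      Equiv.trans_apply, Equiv.symm_apply_apply, shift]
    constructor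
    · rintro ⟨j, rfl⟩
      exact ⟨j - i, rfl⟩
    · rintro ⟨j, rfl⟩
      exact ⟨j + i, by rw [add_sub_cancel_right]⟩
  refine ⟨dup (σ.symm.trans (Equiv.subRight i)) * tau (u ∘ σ.symm), ?_⟩
  rw [image_dup_mul_tau_AM hS (σ.symm.trans (Equiv.subRight i)) (u ∘ σ.symm) ?_, himage]
  rintro _ ⟨_, ⟨j, rfl⟩, rfl⟩
  have hsum : ∑ᶠ a ∈ fanoLine j, u a = u j + (u (j + 1) + u (j + 3)) :=
    finsum_mem_triple u (by revert j; decide) (by revert j; decide) (by revert j; decide)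
  rw [finsum_mem_image σ.injective.injOn]
  simp only [Set.image_image, Equiv.trans_apply, Equiv.symm_apply_apply, shift,
    Function.comp_apply, hsum, hu, fanoLine_injective.eq_iff, sub_eq_zero]

end Fano

/-- STATEMENT 19: Assmus–Mattson systems `S^θ`, `S^{θ'}` over an `STS(7)` with numbers of
zeros of `θ, θ'` in `{1,2,5,6}` are isomorphic `STS(15)`s. -/
theorem stmt19 (S : Set (Set (Fin 7))) (hS : IsSTS S) (θ θ' : Set (Fin 7) → ZMod 2)
    (hθ : {s ∈ S | θ s = 0}.ncard ∈ ({1, 2, 5, 6} : Set ℕ))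
    (hθ' : {s ∈ S | θ' s = 0}.ncard ∈ ({1, 2, 5, 6} : Set ℕ)) :
    IsSTS (AM S θ) ∧ IsSTS (AM S θ') ∧
    ∃ π : Equiv.Perm (Fin 7 ⊕ Unit ⊕ Fin 7),
      (Set.image π) '' (AM S θ) = AM S θ' := by
  obtain ⟨π, hπ⟩ := exists_image_AM_eq hS hθ
  obtain ⟨π', hπ'⟩ := exists_image_AM_eq hS hθ'
  refine ⟨hS.AM θ, hS.AM θ', π.trans π'.symm, ?_⟩
  have h : Set.image (π.trans π'.symm) = Set.image π'.symm ∘ Set.image π := by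
    rw [Equiv.coe_trans, Set.image_comp_eq]
  rw [h, Set.image_comp, hπ, ← hπ', ← Set.image_comp, ← Set.image_comp_eq]
  simp
end
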